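/- Let P : ℝ^n → ℝ be convex and differentiable with ∇P Lipschitz continuous with constant h > 0, let Q : ℝ^n → (−∞, +∞] be proper, lower semicontinuous, and convex, and set Ψ = P + Q. Suppose λ* ∈ ℝ^n is a minimizer of Ψ. Let the sequence {λ(k)}_{k∈ℕ} be generated by the dual proximal gradient iteration λ(k+1) = prox^{1/h}_Q[ λ(k) − (1/h)∇P(λ(k)) ] from an initial point λ(0) with Ψ(λ(0)) finite. Then for every integer K ≥ 1, Ψ(λ(K)) − Ψ(λ*) ≤ h‖λ(0) − λ*‖² / (2K). -/

import Mathlib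

open scoped RealInnerProductSpace

noncomputable section

/-- A proper extended-real-valued function: never `⊥` and not identically `⊤`. -/
def ProperE {E : Type*} (f : E → EReal) : Prop :=
  (∀ x, f x ≠ ⊥) ∧ (∃ x, f x ≠ ⊤)

/-- Convexity for extended-real-valued functions. -/
def ERealConvexOn {E : Type*} [AddCommGroup E] [Module ℝ E] (f : E → EReal) : Prop :=
  ∀ x y : E, ∀ a b : ℝ, 0 ≤ a → 0 ≤ b → a + b = 1 →
    f (a • x + b • y) ≤ (a : EReal) * f x + (b : EReal) * f y

section ProximalGradient

variable {E : Type*} [NormedAddCommGroup E] [InnerProductSpace ℝ E]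

theorem HasGradientAt.hasDerivAt_comp_add_smul [CompleteSpace E] {P : E → ℝ} {g x d : E} {t : ℝ}
    (hP : HasGradientAt P g (x + t • d)) :
    HasDerivAt (fun s : ℝ => P (x + s • d)) ⟪g, d⟫ t := by
  have hline : HasDerivAt (fun s : ℝ => x + s • d) d t := by
    simpa using ((hasDerivAt_id t).smul_const d).const_add x
  have := hP.hasFDerivAt.comp_hasDerivAt t hline
  rwa [InnerProductSpace.toDual_apply_apply] at this

/-- First-order characterization of convexity. -/
theorem ConvexOn.add_inner_gradient_le [CompleteSpace E] {P : E → ℝ} {g x : E}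
    (hconv : ConvexOn ℝ Set.univ P) (hP : HasGradientAt P g x) (z : E) :
    P x + ⟪g, z - x⟫ ≤ P z := by
  have hd : HasDerivAt (fun s : ℝ => P (x + s • (z - x))) ⟪g, z - x⟫ 0 :=
    HasGradientAt.hasDerivAt_comp_add_smul (by simpa using hP)
  have hc : ConvexOn ℝ Set.univ (fun s : ℝ => P (x + s • (z - x))) := by
    refine ⟨convex_univ, fun s _ t _ a b ha hb hab => ?_⟩
    have key := hconv.2 (Set.mem_univ (x + s • (z - x))) (Set.mem_univ (x + t • (z - x)))
      ha hb hab
    convert key using 2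
    obtain rfl : b = 1 - a := by linarith
    simp only [smul_eq_mul]
    module
  have := hc.le_slope_of_hasDerivAt (Set.mem_univ 0) (Set.mem_univ 1) one_pos hd
  simp [slope_def_field] at this
  linarith

/-- The descent lemma: the quadratic upper bound for a function with Lipschitz gradient. -/
theorem le_add_inner_gradient_add_sq [CompleteSpace E] {P : E → ℝ} {G : E → E} {h : ℝ}
    (hP : ∀ x, HasGradientAt P (G x) x)
    (hLip : ∀ u v, ‖G u - G v‖ ≤ h * ‖u - v‖) (x p : E) :
    P p ≤ P x + ⟪G x, p - x⟫ + h / 2 * ‖p - x‖ ^ 2 := by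
  set d := p - x with hd
  have hf : ∀ t : ℝ, HasDerivAt (fun s : ℝ => P (x + s • d)) ⟪G (x + t • d), d⟫ t := fun t =>
    (hP _).hasDerivAt_comp_add_smul
  have hB : ∀ t : ℝ, HasDerivAt (fun s : ℝ => P x + s * ⟪G x, d⟫ + h / 2 * ‖d‖ ^ 2 * s ^ 2)
      (⟪G x, d⟫ + h * ‖d‖ ^ 2 * t) t := fun t => by
    refine ((((hasDerivAt_id t).mul_const ⟪G x, d⟫).const_add (P x)).add
      ((hasDerivAt_pow 2 t).const_mul (h / 2 * ‖d‖ ^ 2))).congr_deriv ?_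
    norm_num
    ring
  have key := image_le_of_deriv_right_le_deriv_boundary (a := 0) (b := 1)
    (fun t _ => (hf t).continuousAt.continuousWithinAt) (fun t _ => (hf t).hasDerivWithinAt)
    (by simp) (fun t _ => (hB t).continuousAt.continuousWithinAt)
    (fun t _ => (hB t).hasDerivWithinAt)
    (fun t ht => by
      have h1 : ⟪G (x + t • d) - G x, d⟫ ≤ h * (t * ‖d‖) * ‖d‖ := by
        refine (real_inner_le_norm _ _).trans ?_
        gcongr
        simpa [norm_smul, abs_of_nonneg ht.1] using hLip (x + t • d) x
      rw [inner_sub_left] at h1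
      nlinarith) (Set.right_mem_Icc.2 zero_le_one)
  simpa [hd] using key

/-- The variational inequality satisfied by a proximal point. -/
theorem ERealConvexOn.sub_le_inner_of_isProx {Q : E → EReal} (hQ : ERealConvexOn Q) {h : ℝ}
    {p w z : E} {a b : ℝ} (hp : Q p = a) (hz : Q z = b)
    (hprox : ∀ v, Q p + ((h / 2 * ‖p - w‖ ^ 2 : ℝ) : EReal)
      ≤ Q v + ((h / 2 * ‖v - w‖ ^ 2 : ℝ) : EReal)) :
    a - b ≤ h * ⟪p - w, z - p⟫ := by
  have key : ∀ t ∈ Set.Ioc (0 : ℝ) 1,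
      a - b ≤ h * ⟪p - w, z - p⟫ + t * (h / 2 * ‖z - p‖ ^ 2) := by
    rintro t ⟨ht0, ht1⟩
    have h1 := hQ p z (1 - t) t (by linarith) ht0.le (by ring)
    have h2 := (hprox ((1 - t) • p + t • z)).trans (add_le_add_left h1 _)
    rw [hp, hz] at h2
    norm_cast at h2
    have h3 : (1 - t) • p + t • z - w = (p - w) + t • (z - p) := by module
    rw [h3, norm_add_sq_real, inner_smul_right, norm_smul, Real.norm_eq_abs, mul_pow,
      sq_abs] at h2
    refine le_of_mul_le_mul_left ?_ ht0
    linarith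
  have hlim : Filter.Tendsto (fun t : ℝ => h * ⟪p - w, z - p⟫ + t * (h / 2 * ‖z - p‖ ^ 2))
      (nhdsWithin 0 (Set.Ioi 0)) (nhds (h * ⟪p - w, z - p⟫)) := by
    have : Continuous fun t : ℝ => h * ⟪p - w, z - p⟫ + t * (h / 2 * ‖z - p‖ ^ 2) := by
      fun_prop
    simpa using (this.tendsto 0).mono_left nhdsWithin_le_nhds
  exact ge_of_tendsto hlim
    (Filter.eventually_of_mem (Ioc_mem_nhdsGT one_pos) key)

/-- One step of the proximal gradient method with step-size `1 / h`, compared with a point `z`. -/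
theorem proximal_gradient_step [CompleteSpace E] {P : E → ℝ} {G : E → E} {h : ℝ} (hh : 0 < h)
    (hconv : ConvexOn ℝ Set.univ P) (hP : ∀ x, HasGradientAt P (G x) x)
    (hLip : ∀ u v, ‖G u - G v‖ ≤ h * ‖u - v‖)
    {Q : E → EReal} (hQ : ERealConvexOn Q) {x p z : E} {a b : ℝ} (hp : Q p = a) (hz : Q z = b)
    (hprox : ∀ v, Q p + ((h / 2 * ‖p - (x - (1 / h) • G x)‖ ^ 2 : ℝ) : EReal)
      ≤ Q v + ((h / 2 * ‖v - (x - (1 / h) • G x)‖ ^ 2 : ℝ) : EReal)) :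
    (P p + a) - (P z + b) ≤ h / 2 * (‖x - z‖ ^ 2 - ‖p - z‖ ^ 2) := by
  have h1 := hQ.sub_le_inner_of_isProx hp hz hprox
  have h2 := le_add_inner_gradient_add_sq hP hLip x p
  have h3 := hconv.add_inner_gradient_le (hP x) z
  have h4 : h * ⟪p - (x - (1 / h) • G x), z - p⟫ = h * ⟪p - x, z - p⟫ + ⟪G x, z - p⟫ := by
    rw [show p - (x - (1 / h) • G x) = (p - x) + (1 / h) • G x by abel, inner_add_left,
      real_inner_smul_left]
    field_simp
  have h5 : ‖x - z‖ ^ 2 = ‖p - x‖ ^ 2 + 2 * ⟪p - x, z - p⟫ + ‖p - z‖ ^ 2 := by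
    rw [norm_sub_rev x z, norm_sub_rev p z, ← norm_add_sq_real]
    congr 2
    abel
  have h6 : ⟪G x, z - x⟫ = ⟪G x, z - p⟫ + ⟪G x, p - x⟫ := by
    rw [← inner_add_right]
    congr 1
    abel
  rw [h5]
  linarith

end ProximalGradient

/-- sublinear convergence of the (dual) proximal gradient iteration
`λ(k+1) = prox^{1/h}_Q[λ(k) − (1/h)∇P(λ(k))]` with step-size `1/h`:
`Ψ(λ(K)) − Ψ(λ*) ≤ h‖λ(0) − λ*‖²/(2K)`.  The iterate `λ(k+1)` is characterized as the
minimizer of `v ↦ Q(v) + (h/2)‖v − (λ(k) − (1/h)∇P(λ(k)))‖²`. -/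
theorem stmt5 {n : ℕ} (h : ℝ) (hh : 0 < h)
    (P : EuclideanSpace ℝ (Fin n) → ℝ)
    (gradP : EuclideanSpace ℝ (Fin n) → EuclideanSpace ℝ (Fin n))
    (hPconv : ConvexOn ℝ Set.univ P)
    (hPdiff : ∀ x, HasGradientAt P (gradP x) x)
    (hLip : ∀ u v, ‖gradP u - gradP v‖ ≤ h * ‖u - v‖)
    (Q : EuclideanSpace ℝ (Fin n) → EReal)
    (hQproper : ProperE Q) (hQlsc : LowerSemicontinuous Q) (hQconv : ERealConvexOn Q)
    (lam : ℕ → EuclideanSpace ℝ (Fin n)) (lamstar : EuclideanSpace ℝ (Fin n))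
    (hmin : ∀ x, (P lamstar : EReal) + Q lamstar ≤ (P x : EReal) + Q x)
    (hfin : ∃ r : ℝ, (P (lam 0) : EReal) + Q (lam 0) = (r : EReal))
    (hiter : ∀ k : ℕ, ∀ v : EuclideanSpace ℝ (Fin n),
      Q (lam (k + 1)) +
          ((h / 2 * ‖lam (k + 1) - (lam k - (1 / h) • gradP (lam k))‖ ^ 2 : ℝ) : EReal)
        ≤ Q v + ((h / 2 * ‖v - (lam k - (1 / h) • gradP (lam k))‖ ^ 2 : ℝ) : EReal)) :
    ∀ K : ℕ, 1 ≤ K →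
      ((P (lam K) : EReal) + Q (lam K)) - ((P lamstar : EReal) + Q lamstar)
        ≤ ((h * ‖lam 0 - lamstar‖ ^ 2 / (2 * K) : ℝ) : EReal) := by
  obtain ⟨r, hr⟩ := hfin
  have hstar : ∃ b : ℝ, Q lamstar = b := by
    have h1 := hmin (lam 0)
    rw [hr] at h1
    have htop : Q lamstar ≠ ⊤ := fun ht => by simp [ht] at h1
    exact ⟨_, (EReal.coe_toReal htop (hQproper.1 _)).symm⟩
  obtain ⟨b, hb⟩ := hstar
  have hreal : ∀ k, ∃ a : ℝ, Q (lam k) = a := by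
    intro k
    have htop : Q (lam k) ≠ ⊤ := by
      intro ht
      cases k with
      | zero => simp [ht] at hr
      | succ k =>
        have h1 := hiter k lamstar
        rw [ht, hb, EReal.top_add_coe, ← EReal.coe_add] at h1
        exact EReal.coe_ne_top _ (top_le_iff.1 h1)
    exact ⟨_, (EReal.coe_toReal htop (hQproper.1 _)).symm⟩
  choose a ha using hreal
  have hstep : ∀ k {z : EuclideanSpace ℝ (Fin n)} {c : ℝ}, Q z = c →
      (P (lam (k + 1)) + a (k + 1)) - (P z + c)
        ≤ h / 2 * (‖lam k - z‖ ^ 2 - ‖lam (k + 1) - z‖ ^ 2) := fun k _ _ hz =>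
    proximal_gradient_step hh hPconv hPdiff hLip hQconv (ha (k + 1)) hz (hiter k)
  have hsum : ∀ K : ℕ, K * ((P (lam K) + a K) - (P lamstar + b))
      ≤ h / 2 * (‖lam 0 - lamstar‖ ^ 2 - ‖lam K - lamstar‖ ^ 2) := by
    intro K
    induction K with
    | zero => simp
    | succ K ih =>
      have hdec : P (lam (K + 1)) + a (K + 1) ≤ P (lam K) + a K := by
        have h1 := hstep K (ha K)
        have h2 : 0 ≤ h / 2 * ‖lam (K + 1) - lam K‖ ^ 2 := by positivity
        simp only [sub_self, norm_zero] at h1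
        linarith
      have h3 := mul_le_mul_of_nonneg_left hdec (Nat.cast_nonneg (α := ℝ) K)
      have h4 := hstep K hb
      push_cast
      linarith
  intro K hK
  have hK' : (0 : ℝ) < K := by exact_mod_cast hK
  rw [ha K, hb]
  norm_cast
  push_cast
  rw [le_div_iff₀ (by positivity)]
  have h1 := hsum K
  have h2 : 0 ≤ h / 2 * ‖lam K - lamstar‖ ^ 2 := by positivity
  linarith
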